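/- (1) For every u' in N'_{m_K} and u in N_{n_K}, there exist unique u_1 in N_{n_K}, h in H_1, and u'_1 in N'_{m_K} such that u'*u = u_1*h*u'_1. (2) Fix u' in N'_{m_K} and, for u in N_{n_K}, write u_1(u) for the N_{n_K}-component of this decomposition of u'*u; then for all integers m > l >= 0, one has u in N_{n_K+l} if and only if u_1(u) in N_{n_K+l}, and the induced map on cosets is a bijection of N_{n_K+l}/N_{n_K+m} onto itself. -/

import Mathlib

open scoped Classical

noncomputable section

namespace U21

/-- The arithmetic setting: `E` is the unramified quadratic extension of a non-archimedean
local field `F` of odd residue characteristic `p`, with residue field of `F` of cardinality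
`q = p ^ fdeg`.  The field `E` is encoded through its valuation subring `O = o_E`, a
uniformizer `ϖ`, the maximal ideal `mI` (so that `p_E^k` is `ϖ ^ k * O`), and the nontrivial
`F`-automorphism `conj` of `E` (which induces the `q`-power Frobenius on the residue field
of `E`, of cardinality `q ^ 2`). -/
structure Setting where
  p : ℕ
  q : ℕ
  fdeg : ℕ
  hp : p.Prime
  hodd : p ≠ 2
  hfdeg : 0 < fdeg
  hq : q = p ^ fdeg
  E : Type
  [fieldE : Field E]
  conj : E →+* E
  conj_invol : ∀ x, conj (conj x) = x
  conj_ne : conj ≠ RingHom.id E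
  O : Subring E
  val_ring : ∀ x : E, x ≠ 0 → x ∈ O ∨ x⁻¹ ∈ O
  conj_O : ∀ x, x ∈ O → conj x ∈ O
  ϖ : E
  unif_mem : ϖ ∈ O
  unif_ne : ϖ ≠ 0
  unif_conj : conj ϖ = ϖ
  unif_not_unit : ¬ IsUnit (⟨ϖ, unif_mem⟩ : O)
  disc : ∀ x : E, x ≠ 0 → ∃ (n : ℤ) (u : Oˣ), x = (u : O) * ϖ ^ n
  mI : Ideal O
  hmI : ∀ x : O, x ∈ mI ↔ ∃ y ∈ O, (x : E) = ϖ * y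
  [fin_res : Fintype (O ⧸ mI)]
  card_res : Fintype.card (O ⧸ mI) = q ^ 2
  res_frob : ∀ x : O, Ideal.Quotient.mk mI ⟨conj x, conj_O x x.2⟩ = (Ideal.Quotient.mk mI x) ^ q
  complete : ∀ a : ℕ → E,
    (∀ k : ℕ, ∃ N, ∀ m ≥ N, ∀ n ≥ N, ∃ w ∈ O, a m - a n = ϖ ^ k * w) →
    ∃ L : E, ∀ k : ℕ, ∃ N, ∀ n ≥ N, ∃ w ∈ O, a n - L = ϖ ^ k * w

attribute [instance] Setting.fieldE Setting.fin_res

namespace Setting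

variable (S : Setting)

/-- 3×3 matrices over `E`. -/
abbrev M3 := Matrix (Fin 3) (Fin 3) S.E

/-- The antidiagonal matrix `β` of the Hermitian form. -/
def betaM : S.M3 := !![0,0,1;0,1,0;1,0,0]

/-- The fractional ideal `p_E ^ k ⊆ E` (for `k : ℤ`). -/
def pE (k : ℤ) : Set S.E := {z | ∃ w ∈ S.O, z = S.ϖ ^ k * w}

/-- The unramified unitary group `G = U(2,1)(E/F)`, as a subgroup of `GL₃(E)`:
`g ∈ G` iff `g.transpose * β * conj g = β`. -/
def Gsub : Subgroup (Matrix.GeneralLinearGroup (Fin 3) S.E) where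
  carrier := {g | ((g : S.M3)).transpose * S.betaM * ((g : S.M3).map S.conj) = S.betaM}
  one_mem' := by
    simp [Matrix.map_one (⇑S.conj) (map_zero S.conj) (map_one S.conj)]
  mul_mem' := by
    intro a b ha hb
    simp only [Set.mem_setOf_eq, Units.val_mul, Matrix.transpose_mul, Matrix.map_mul] at ha hb ⊢
    calc ((b : S.M3)).transpose * ((a : S.M3)).transpose * S.betaM * ((a : S.M3).map S.conj * (b : S.M3).map S.conj)
        = ((b : S.M3)).transpose * (((a : S.M3)).transpose * S.betaM * (a : S.M3).map S.conj) * ((b : S.M3).map S.conj) := by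
          simp only [mul_assoc]
      _ = S.betaM := by rw [ha]; exact hb
  inv_mem' := by
    intro a ha
    simp only [Set.mem_setOf_eq] at ha ⊢
    have hA : IsUnit ((a : S.M3)) := a.isUnit
    have hdet : IsUnit ((a : S.M3)).det := (Matrix.isUnit_iff_isUnit_det _).mp hA
    have hAc : IsUnit (((a : S.M3)).map ⇑S.conj) := by
      rw [← RingHom.mapMatrix_apply]; exact hA.map _
    have hdetc : IsUnit ((((a : S.M3)).map ⇑S.conj).det) := (Matrix.isUnit_iff_isUnit_det _).mp hAc
    have hdetT : IsUnit ((((a : S.M3)).transpose).det) := by rw [Matrix.det_transpose]; exact hdet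
    have hmapinv : ((a : S.M3)⁻¹).map ⇑S.conj = (((a : S.M3)).map ⇑S.conj)⁻¹ := by
      symm
      apply Matrix.inv_eq_left_inv
      rw [← Matrix.map_mul, Matrix.nonsing_inv_mul _ hdet,
        Matrix.map_one (⇑S.conj) (map_zero S.conj) (map_one S.conj)]
    rw [Matrix.coe_units_inv, Matrix.transpose_nonsing_inv, hmapinv]
    conv_lhs => rw [← ha]
    calc (((a:S.M3)).transpose)⁻¹ * (((a:S.M3)).transpose * S.betaM * ((a:S.M3)).map ⇑S.conj) * (((a:S.M3)).map ⇑S.conj)⁻¹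
        = (((a:S.M3)).transpose)⁻¹ * ((a:S.M3)).transpose * S.betaM *
            (((a:S.M3)).map ⇑S.conj * (((a:S.M3)).map ⇑S.conj)⁻¹) := by simp only [mul_assoc]
      _ = S.betaM := by
          rw [Matrix.nonsing_inv_mul _ hdetT, Matrix.mul_nonsing_inv _ hdetc, one_mul, mul_one]

/-- The group `G = U(2,1)(E/F)`. -/
abbrev GG := ↥S.Gsub

/-- The matrix of an element of `G`. -/
def mat (g : S.GG) : S.M3 := ((g : Matrix.GeneralLinearGroup (Fin 3) S.E) : S.M3)

/-- The upper unipotent matrix `n(x,y)`. -/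
def nM (x y : S.E) : S.M3 := !![1, x, y; 0, 1, -S.conj x; 0, 0, 1]

/-- The lower unipotent matrix `n'(x,y)`. -/
def n'M (x y : S.E) : S.M3 := !![1, 0, 0; x, 1, 0; y, -S.conj x, 1]

/-- The diagonal matrix `h(x) = diag(x, -x̄x⁻¹, x̄⁻¹)`. -/
def hM (x : S.E) : S.M3 := !![x, 0, 0; 0, -S.conj x * x⁻¹, 0; 0, 0, (S.conj x)⁻¹]

/-- The subgroup `N` of `G` (unipotent radical of the upper triangular Borel), as a set. -/
def Nset : Set S.GG := {g | ∃ x y : S.E, x * S.conj x + y + S.conj y = 0 ∧ S.mat g = S.nM x y}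

/-- The subgroup `N_k = {n(x,y) : y ∈ p_E^k}`, as a set. -/
def Nk (k : ℤ) : Set S.GG :=
  {g | ∃ x y : S.E, x * S.conj x + y + S.conj y = 0 ∧ y ∈ S.pE k ∧ S.mat g = S.nM x y}

/-- The subgroup `N'` of `G`, as a set. -/
def N'set : Set S.GG := {g | ∃ x y : S.E, x * S.conj x + y + S.conj y = 0 ∧ S.mat g = S.n'M x y}

/-- The subgroup `N'_k = {n'(x,y) : y ∈ p_E^k}`, as a set. -/
def N'k (k : ℤ) : Set S.GG :=
  {g | ∃ x y : S.E, x * S.conj x + y + S.conj y = 0 ∧ y ∈ S.pE k ∧ S.mat g = S.n'M x y}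

/-- The diagonal subgroup `H` of `G`, as a set. -/
def Hset : Set S.GG := {g | ∃ a b c : S.E, S.mat g = !![a,0,0;0,b,0;0,0,c]}

/-- The hyperspecial maximal compact subgroup `K₀ = G ∩ GL₃(o_E)`, as a set. -/
def K0set : Set S.GG := {g | ∀ i j, S.mat g i j ∈ S.O}

/-- The special (non-hyperspecial) maximal compact subgroup `K₁`, as a set. -/
def K1set : Set S.GG :=
  {g | S.mat g 0 0 ∈ S.O ∧ S.mat g 0 1 ∈ S.O ∧ S.mat g 0 2 ∈ S.pE (-1) ∧
       S.mat g 1 0 ∈ S.pE 1 ∧ S.mat g 1 1 ∈ S.O ∧ S.mat g 1 2 ∈ S.O ∧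
       S.mat g 2 0 ∈ S.pE 1 ∧ S.mat g 2 1 ∈ S.pE 1 ∧ S.mat g 2 2 ∈ S.O}

/-- The Iwahori subgroup `I_{K₀}` (preimage of the Borel of `Γ_{K₀}`), as a set. -/
def IK0 : Set S.GG :=
  {g | g ∈ S.K0set ∧ S.mat g 1 0 ∈ S.pE 1 ∧ S.mat g 2 0 ∈ S.pE 1 ∧ S.mat g 2 1 ∈ S.pE 1}

/-- The pro-p Iwahori subgroup `I_{1,K₀}`, as a set. -/
def I1K0 : Set S.GG :=
  {g | g ∈ S.IK0 ∧ S.mat g 0 0 - 1 ∈ S.pE 1 ∧ S.mat g 1 1 - 1 ∈ S.pE 1 ∧ S.mat g 2 2 - 1 ∈ S.pE 1}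

/-- The opposite pro-p Iwahori subgroup `I'_{1,K₀}`, as a set. -/
def I1'K0 : Set S.GG :=
  {g | g ∈ S.K0set ∧ S.mat g 0 1 ∈ S.pE 1 ∧ S.mat g 0 2 ∈ S.pE 1 ∧ S.mat g 1 2 ∈ S.pE 1 ∧
       S.mat g 0 0 - 1 ∈ S.pE 1 ∧ S.mat g 1 1 - 1 ∈ S.pE 1 ∧ S.mat g 2 2 - 1 ∈ S.pE 1}

/-- The maximal normal pro-p subgroup `K₀¹` of `K₀` (principal congruence subgroup), as a set. -/
def Kone0 : Set S.GG := {g | ∀ i j, S.mat g i j - (1 : S.M3) i j ∈ S.pE 1}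

/-- The Iwahori subgroup `I_{K₁}`, as a set. -/
def IK1 : Set S.GG := {g | g ∈ S.K1set ∧ S.mat g 2 0 ∈ S.pE 2}

/-- The pro-p Iwahori subgroup `I_{1,K₁}`, as a set. -/
def I1K1 : Set S.GG :=
  {g | g ∈ S.IK1 ∧ S.mat g 0 0 - 1 ∈ S.pE 1 ∧ S.mat g 1 1 - 1 ∈ S.pE 1 ∧ S.mat g 2 2 - 1 ∈ S.pE 1}

/-- The opposite pro-p Iwahori subgroup `I'_{1,K₁}`, as a set. -/
def I1'K1 : Set S.GG :=
  {g | g ∈ S.K1set ∧ S.mat g 0 2 ∈ S.O ∧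
       S.mat g 0 0 - 1 ∈ S.pE 1 ∧ S.mat g 1 1 - 1 ∈ S.pE 1 ∧ S.mat g 2 2 - 1 ∈ S.pE 1}

/-- The maximal normal pro-p subgroup `K₁¹` of `K₁`, as a set. -/
def Kone1 : Set S.GG :=
  {g | g ∈ S.K1set ∧ S.mat g 0 2 ∈ S.O ∧ S.mat g 2 0 ∈ S.pE 2 ∧
       S.mat g 0 0 - 1 ∈ S.pE 1 ∧ S.mat g 1 1 - 1 ∈ S.pE 1 ∧ S.mat g 2 2 - 1 ∈ S.pE 1}

/-- The congruence subgroup of level `n` (used to express smoothness), as a set. -/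
def cong (n : ℕ) : Set S.GG := {g | ∀ i j, S.mat g i j - (1 : S.M3) i j ∈ S.pE n}

def alphaM : S.M3 := !![S.ϖ⁻¹, 0, 0; 0, 1, 0; 0, 0, S.ϖ]

def alphaMinv : S.M3 := !![S.ϖ, 0, 0; 0, 1, 0; 0, 0, S.ϖ⁻¹]

lemma alpha_mul_inv : S.alphaM * S.alphaMinv = 1 := by
  ext i j
  fin_cases i <;> fin_cases j <;>
    simp [alphaM, alphaMinv, Matrix.mul_apply, Fin.sum_univ_three, Matrix.one_apply,
      Matrix.vecHead, Matrix.vecTail, inv_mul_cancel₀ S.unif_ne, mul_inv_cancel₀ S.unif_ne]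

lemma alpha_inv_mul : S.alphaMinv * S.alphaM = 1 := by
  ext i j
  fin_cases i <;> fin_cases j <;>
    simp [alphaM, alphaMinv, Matrix.mul_apply, Fin.sum_univ_three, Matrix.one_apply,
      Matrix.vecHead, Matrix.vecTail, inv_mul_cancel₀ S.unif_ne, mul_inv_cancel₀ S.unif_ne]

def alphaU : Matrix.GeneralLinearGroup (Fin 3) S.E :=
  ⟨S.alphaM, S.alphaMinv, S.alpha_mul_inv, S.alpha_inv_mul⟩

lemma alphaU_mem : S.alphaU ∈ S.Gsub := by
  show ((S.alphaU : S.M3)).transpose * S.betaM * ((S.alphaU : S.M3).map S.conj) = S.betaM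
  have : (S.alphaU : S.M3) = S.alphaM := rfl
  rw [this]
  ext i j
  fin_cases i <;> fin_cases j <;>
    simp [alphaM, betaM, Matrix.mul_apply, Fin.sum_univ_three, Matrix.map_apply,
      Matrix.transpose_apply, Matrix.vecHead, Matrix.vecTail, map_inv₀, S.unif_conj,
      inv_mul_cancel₀ S.unif_ne, mul_inv_cancel₀ S.unif_ne]

/-- The element `α = diag(ϖ⁻¹, 1, ϖ)` of `G`. -/
def alphaE : S.GG := ⟨S.alphaU, S.alphaU_mem⟩

lemma beta_mul_beta : S.betaM * S.betaM = 1 := by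
  ext i j
  fin_cases i <;> fin_cases j <;>
    simp [betaM, Matrix.mul_apply, Fin.sum_univ_three, Matrix.one_apply,
      Matrix.vecHead, Matrix.vecTail]

def betaU : Matrix.GeneralLinearGroup (Fin 3) S.E :=
  ⟨S.betaM, S.betaM, S.beta_mul_beta, S.beta_mul_beta⟩

lemma betaU_mem : S.betaU ∈ S.Gsub := by
  show ((S.betaU : S.M3)).transpose * S.betaM * ((S.betaU : S.M3).map S.conj) = S.betaM
  have : (S.betaU : S.M3) = S.betaM := rfl
  rw [this]
  ext i j
  fin_cases i <;> fin_cases j <;>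
    simp [betaM, Matrix.mul_apply, Fin.sum_univ_three, Matrix.map_apply, Matrix.transpose_apply,
      Matrix.vecHead, Matrix.vecTail]

/-- The element `β` of `G`. -/
def betaE : S.GG := ⟨S.betaU, S.betaU_mem⟩

/-- The element `β' = β * α⁻¹` of `G`. -/
def betaPr : S.GG := S.betaE * S.alphaE⁻¹

/-- A finite set `U` is a set of representatives for the cosets `A/B`. -/
def IsReps (A B : Set S.GG) (U : Finset S.GG) : Prop :=
  (↑U : Set S.GG) ⊆ A ∧ ∀ a ∈ A, ∃! u, u ∈ U ∧ a⁻¹ * u ∈ B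

/-- The residue field `k_E` of `E`. -/
abbrev kE := S.O ⧸ S.mI

/-- The residue map `o_E → k_E`. -/
def resmap : S.O →+* S.kE := Ideal.Quotient.mk S.mI

/-- The group `L_{q³} = {(x,t) ∈ k_E² : x x̄ + t + t̄ = 0}` (where `x̄ = x^q`). -/
def Lbig : Set (S.kE × S.kE) := {z | z.1 * z.1 ^ S.q + z.2 + z.2 ^ S.q = 0}

/-- The group `L_q = {(0,t) ∈ k_E² : t + t̄ = 0}`. -/
def Lsmall : Set (S.kE × S.kE) := {z | z.1 = 0 ∧ z.2 + z.2 ^ S.q = 0}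

/-- `L_{q^t}` for `t ∈ {1,3}`. -/
def Lof (t : ℕ) : Set (S.kE × S.kE) := if t = 3 then S.Lbig else S.Lsmall

end Setting

/-- A choice of one of the two maximal compact open subgroups `K ∈ {K₀, K₁}` of `G`,
together with its maximal normal pro-p subgroup `K¹`, the (pro-p) Iwahori subgroups
`I_K ⊇ I_{1,K}`, the opposite pro-p Iwahori `I'_{1,K}`, the element
`β_K ∈ K ∩ {β, β'}`, and the integers `n_K, m_K, t_K`. -/
structure Chamber (S : Setting) where
  K : Subgroup S.GG
  KoneS : Set S.GG
  IK : Set S.GG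
  I1 : Set S.GG
  I1' : Set S.GG
  βK : S.GG
  nK : ℤ
  mK : ℤ
  tK : ℕ
  cases :
    ((K : Set S.GG) = S.K0set ∧ KoneS = S.Kone0 ∧ IK = S.IK0 ∧ I1 = S.I1K0 ∧ I1' = S.I1'K0 ∧
      βK = S.betaE ∧ nK = 0 ∧ mK = 1 ∧ tK = 3) ∨
    ((K : Set S.GG) = S.K1set ∧ KoneS = S.Kone1 ∧ IK = S.IK1 ∧ I1 = S.I1K1 ∧ I1' = S.I1'K1 ∧
      βK = S.betaPr ∧ nK = -1 ∧ mK = 2 ∧ tK = 1)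

namespace Chamber

variable {S : Setting} (C : Chamber S)

/-- `H₀ = H ∩ I_K`. -/
def H0 : Set S.GG := S.Hset ∩ C.IK

/-- `H₁ = H ∩ I_{1,K}`. -/
def H1 : Set S.GG := S.Hset ∩ C.I1

end Chamber

section RepTheory

variable {S : Setting} (C : Chamber S)
variable (𝔽 : Type) [Field 𝔽]

section Generic

variable {G₀ : Type} [Monoid G₀] {V : Type} [AddCommGroup V] [Module 𝔽 V]

/-- A submodule is invariant under a representation. -/
def Invt (ρ : Representation 𝔽 G₀ V) (Ssub : Submodule 𝔽 V) : Prop :=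
  ∀ g v, v ∈ Ssub → ρ g v ∈ Ssub

/-- The subrepresentation generated by a vector (the span of its orbit). -/
def orbitSpan (ρ : Representation 𝔽 G₀ V) (v : V) : Submodule 𝔽 V :=
  Submodule.span 𝔽 {w | ∃ g, w = ρ g v}

/-- The subrepresentation generated by a vector under a subset `A` of the group. -/
def orbitSpanOn (ρ : Representation 𝔽 G₀ V) (A : Set G₀) (v : V) : Submodule 𝔽 V :=
  Submodule.span 𝔽 {w | ∃ g ∈ A, w = ρ g v}

/-- The quotient of a representation by an invariant submodule `N` is irreducible:
equivalently (by the lattice correspondence), `N ≠ ⊤` and any invariant submodule lying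
between `N` and `⊤` equals `N` or `⊤`. -/
def QuotientIrreducible (ρ : Representation 𝔽 G₀ V) (N : Submodule 𝔽 V) : Prop :=
  N ≠ ⊤ ∧ ∀ Ssub : Submodule 𝔽 V, Invt 𝔽 ρ Ssub → N ≤ Ssub → Ssub = N ∨ Ssub = ⊤

/-- The submodule of vectors invariant under all elements of the subset `A`. -/
def invariantsOn (ρ : Representation 𝔽 G₀ V) (A : Set G₀) : Submodule 𝔽 V where
  carrier := {v | ∀ g ∈ A, ρ g v = v}
  add_mem' := by
    intro a b ha hb g hg
    rw [map_add, ha g hg, hb g hg]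
  zero_mem' := by
    intro g hg
    rw [map_zero]
  smul_mem' := by
    intro c a ha g hg
    rw [map_smul, ha g hg]

/-- The space `Hom_G(ρ₁, ρ₂)` of equivariant linear maps, as a submodule of the linear maps. -/
def EquivHomSub {V₂ : Type} [AddCommGroup V₂] [Module 𝔽 V₂]
    (ρ₁ : Representation 𝔽 G₀ V) (ρ₂ : Representation 𝔽 G₀ V₂) :
    Submodule 𝔽 (V →ₗ[𝔽] V₂) where
  carrier := {φ | ∀ g x, φ (ρ₁ g x) = ρ₂ g (φ x)}
  add_mem' := by
    intro a b ha hb g x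
    simp only [LinearMap.add_apply, ha g x, hb g x, map_add]
  zero_mem' := by
    intro g x
    simp only [LinearMap.zero_apply, map_zero]
  smul_mem' := by
    intro c a ha g x
    simp only [LinearMap.smul_apply, ha g x, map_smul]

end Generic

section Weight

variable (W : Type) [AddCommGroup W] [Module 𝔽 W]
variable (σ : Representation 𝔽 ↥C.K W)

/-- Extension of `σ` to all of `G` (by `1` outside `K`); used to avoid coercion issues. -/
def sigma' : S.GG → Module.End 𝔽 W := fun g => if h : g ∈ C.K then σ ⟨g, h⟩ else 1

/-- `σ` is a weight of `K`: an irreducible smooth representation of `K` over `𝔽`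
factoring through `Γ_K = K / K¹` (automatically finite dimensional). -/
def IsWeight : Prop :=
  Nontrivial W ∧ FiniteDimensional 𝔽 W ∧
  (∀ Ssub : Submodule 𝔽 W, (∀ (k : ↥C.K) (w : W), w ∈ Ssub → σ k w ∈ Ssub) → Ssub = ⊥ ∨ Ssub = ⊤) ∧
  (∀ (g : S.GG) (hg : g ∈ C.K), g ∈ C.KoneS → σ ⟨g, hg⟩ = LinearMap.id)

/-- `σ` is one dimensional of the form `χ ∘ det`. -/
def IsDetWeight : Prop :=
  Module.finrank 𝔽 W = 1 ∧
  ∃ c : S.E → 𝔽, ∀ (g : S.GG) (hg : g ∈ C.K) (w : W), σ ⟨g, hg⟩ w = c ((S.mat g).det) • w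

/-- `j_σ : σ → σ` is the composition of the coinvariant projection `σ → σ_{I'_{1,K}}`
with the inverse of the natural isomorphism `σ^{I_{1,K}} ≅ σ_{I'_{1,K}}`:
it restricts to the identity on `σ^{I_{1,K}}` and kills the augmentation part of
`σ` with respect to `I'_{1,K}`. -/
def IsJ (jσ : W →ₗ[𝔽] W) : Prop :=
  (∀ w : W, (∀ g ∈ C.I1, sigma' C 𝔽 W σ g w = w) → jσ w = w) ∧
  (∀ (w : W) (g : S.GG), g ∈ C.I1' → jσ (sigma' C 𝔽 W σ g w - w) = 0)

/-- The defining conditions of the compact induction `ind_K^G σ`: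
`K`-equivariance on the left and compact support (finitely many cosets `K g`). -/
def IndCarrier : Set (S.GG → W) :=
  {f | (∀ (k : S.GG) (hk : k ∈ C.K) (g : S.GG), f (k * g) = σ ⟨k, hk⟩ (f g)) ∧
       ∃ s : Finset S.GG, ∀ g : S.GG, f g ≠ 0 → ∃ k ∈ C.K, ∃ t ∈ s, g = k * t}

/-- The compact induction `ind_K^G σ`, as a submodule of `G → W`. -/
def IndSub : Submodule 𝔽 (S.GG → W) where
  carrier := IndCarrier C 𝔽 W σ
  add_mem' := by
    rintro f g ⟨hf1, sf, hf2⟩ ⟨hg1, sg, hg2⟩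
    refine ⟨fun k hk x => by simp [hf1 k hk x, hg1 k hk x], sf ∪ sg, fun x hx => ?_⟩
    by_cases h : f x ≠ 0
    · obtain ⟨k, hk, t, ht, rfl⟩ := hf2 x h
      exact ⟨k, hk, t, Finset.mem_union_left _ ht, rfl⟩
    · push_neg at h
      have hgx : g x ≠ 0 := by
        intro h0
        apply hx
        simp [Pi.add_apply, h, h0]
      obtain ⟨k, hk, t, ht, rfl⟩ := hg2 x hgx
      exact ⟨k, hk, t, Finset.mem_union_right _ ht, rfl⟩
  zero_mem' := ⟨fun k hk g => by simp, ∅, fun g hg => absurd rfl hg⟩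
  smul_mem' := by
    rintro c f ⟨hf1, sf, hf2⟩
    refine ⟨fun k hk g => by simp [hf1 k hk g], sf, fun x hx => ?_⟩
    refine hf2 x ?_
    intro h0
    apply hx
    simp [h0]

lemma indAct_mem (g : S.GG) {f : S.GG → W} (hf : f ∈ IndCarrier C 𝔽 W σ) :
    (fun x => f (x * g)) ∈ IndCarrier C 𝔽 W σ := by
  obtain ⟨h1, s, h2⟩ := hf
  refine ⟨fun k hk x => ?_, s.image (· * g⁻¹), ?_⟩
  · show f (k * x * g) = _
    rw [mul_assoc]
    exact h1 k hk (x * g)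
  intro x hx
  obtain ⟨k, hk, t, ht, hxg⟩ := h2 (x * g) hx
  refine ⟨k, hk, t * g⁻¹, Finset.mem_image_of_mem _ ht, ?_⟩
  rw [← mul_assoc, ← hxg, mul_assoc, mul_inv_cancel, mul_one]

/-- The representation of `G` on `ind_K^G σ` by right translation. -/
def indRep : Representation 𝔽 S.GG ↥(IndSub C 𝔽 W σ) where
  toFun g :=
    { toFun := fun f => ⟨fun x => (f : S.GG → W) (x * g), indAct_mem C 𝔽 W σ g f.2⟩
      map_add' := fun f1 f2 => Subtype.ext (funext fun x => rfl)
      map_smul' := fun c f => Subtype.ext (funext fun x => rfl) }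
  map_one' := LinearMap.ext fun f => Subtype.ext (funext fun x => by simp [mul_one])
  map_mul' g h := LinearMap.ext fun f => Subtype.ext (funext fun x => by simp [mul_assoc])

/-- The function `[g, v] ∈ ind_K^G σ`: supported on `K g⁻¹`, with value `v` at `g⁻¹`. -/
def stdFn (g : S.GG) (v : W) : S.GG → W :=
  fun x => if h : x * g ∈ C.K then σ ⟨x * g, h⟩ v else 0

/-- The characterization of the family `f_n` (`n ∈ ℤ`) of `I_{1,K}`-invariant elements of
`ind_K^G σ`: `f_n` is supported on `K α⁻ⁿ I_{1,K}` and has value at `α⁻ⁿ` equal to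
`σ(β_K) v₀` for `n > 0` and `v₀` for `n ≤ 0`, where `v₀` is a fixed nonzero vector of
`σ^{I_{1,K}}`. -/
def IsFFamily (v0 : W) (ff : ℤ → ↥(IndSub C 𝔽 W σ)) : Prop :=
  v0 ≠ 0 ∧ (∀ g ∈ C.I1, sigma' C 𝔽 W σ g v0 = v0) ∧
  (∀ (n : ℤ) (g : S.GG), g ∈ C.I1 → indRep C 𝔽 W σ g (ff n) = ff n) ∧
  (∀ (n : ℤ) (x : S.GG), (ff n : S.GG → W) x ≠ 0 →
    ∃ k ∈ C.K, ∃ i ∈ C.I1, x = k * S.alphaE ^ (-n) * i) ∧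
  (∀ n : ℤ, 0 < n → (ff n : S.GG → W) (S.alphaE ^ (-n)) = sigma' C 𝔽 W σ C.βK v0) ∧
  (∀ n : ℤ, n ≤ 0 → (ff n : S.GG → W) (S.alphaE ^ (-n)) = v0)

/-- The characterization of the Hecke operator `T ∈ End_G(ind_K^G σ)`:
it is `G`-equivariant and satisfies
`T [1, v] = ∑_{u ∈ N_{n_K}/N_{n_K+2}} [u α⁻¹, j_σ σ(u⁻¹) v]
  + ∑_{u ∈ N_{n_K+1}/N_{n_K+2}} [β_K u α⁻¹, j_σ σ(β_K) v]`. -/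
def IsHeckeT (jσ : W →ₗ[𝔽] W) (T : Module.End 𝔽 ↥(IndSub C 𝔽 W σ)) : Prop :=
  (∀ (g : S.GG) (x : ↥(IndSub C 𝔽 W σ)),
    T (indRep C 𝔽 W σ g x) = indRep C 𝔽 W σ g (T x)) ∧
  (∀ (v : W) (x : ↥(IndSub C 𝔽 W σ)), (x : S.GG → W) = stdFn C 𝔽 W σ 1 v →
    ∀ (U2 U1 : Finset S.GG),
      S.IsReps (S.Nk C.nK) (S.Nk (C.nK + 2)) U2 →
      S.IsReps (S.Nk (C.nK + 1)) (S.Nk (C.nK + 2)) U1 →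
      ((T x : S.GG → W)) =
        (∑ u ∈ U2, stdFn C 𝔽 W σ (u * S.alphaE⁻¹) (jσ (sigma' C 𝔽 W σ u⁻¹ v))) +
        ∑ u ∈ U1, stdFn C 𝔽 W σ (C.βK * u * S.alphaE⁻¹) (jσ (sigma' C 𝔽 W σ C.βK v)))

/-- The eigencharacter `χ_σ` of `H₀/H₁` afforded by the (one-dimensional) space
`σ^{I_{1,K}}` with chosen basis vector `v₀`. -/
def IsChi (v0 : W) (χ : S.GG → 𝔽) : Prop :=
  (∀ h ∈ C.H0, sigma' C 𝔽 W σ h v0 = χ h • v0)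

/-- Right translation on functions `K → 𝔽` (the action on a (finite) principal series). -/
def PSact (k : ↥C.K) (f : ↥C.K → 𝔽) : ↥C.K → 𝔽 := fun x => f (x * k)

/-- The (inflation to `K` of the) finite principal series `Ind_𝔹^{Γ_K} χ`:
functions on `K`, invariant under right translation by `K¹`, left `I_{1,K}`-invariant and
left `(H₀, χ)`-equivariant. -/
def PSchiSub (χ : S.GG → 𝔽) : Submodule 𝔽 (↥C.K → 𝔽) where
  carrier := {f | (∀ b : ↥C.K, (b : S.GG) ∈ C.I1 → ∀ x, f (b * x) = f x) ∧
                  (∀ h : ↥C.K, (h : S.GG) ∈ C.H0 → ∀ x, f (h * x) = χ (h : S.GG) * f x) ∧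
                  (∀ z : ↥C.K, (z : S.GG) ∈ C.KoneS → ∀ x, f (x * z) = f x)}
  add_mem' := by
    rintro f g ⟨hf1, hf2, hf3⟩ ⟨hg1, hg2, hg3⟩
    exact ⟨fun b hb x => by simp [hf1 b hb x, hg1 b hb x],
           fun h hh x => by simp [hf2 h hh x, hg2 h hh x, mul_add],
           fun z hz x => by simp [hf3 z hz x, hg3 z hz x]⟩
  zero_mem' := ⟨fun b hb x => rfl, fun h hh x => by simp, fun z hz x => rfl⟩
  smul_mem' := by
    rintro c f ⟨hf1, hf2, hf3⟩
    refine ⟨fun b hb x => by simp [hf1 b hb x], fun h hh x => ?_, fun z hz x => by simp [hf3 z hz x]⟩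
    simp only [Pi.smul_apply, hf2 h hh x, smul_eq_mul]
    ring

/-- The principal series `Ind_𝔹^{Γ_K} 1` for the trivial character. -/
def PS1sub : Submodule 𝔽 (↥C.K → 𝔽) := PSchiSub C 𝔽 (fun _ => 1)

/-- `σ_{st}` is the Steinberg weight `st = (Ind_𝔹^{Γ_K} 1)/1`: there is a surjective
`K`-equivariant linear map from `Ind_𝔹^{Γ_K} 1` to it whose kernel is exactly the
constant functions. -/
def IsSteinberg {Wst : Type} [AddCommGroup Wst] [Module 𝔽 Wst]
    (σst : Representation 𝔽 ↥C.K Wst) : Prop :=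
  ∃ φ : ↥(PS1sub C 𝔽) →ₗ[𝔽] Wst, Function.Surjective φ ∧
    (∀ f : ↥(PS1sub C 𝔽), φ f = 0 ↔ ∃ c : 𝔽, (f : ↥C.K → 𝔽) = fun _ => c) ∧
    (∀ (k : ↥C.K) (f f' : ↥(PS1sub C 𝔽)),
      (f' : ↥C.K → 𝔽) = PSact C 𝔽 k (f : ↥C.K → 𝔽) → φ f' = σst k (φ f))

/-- `σ` is isomorphic to a twist of the Steinberg weight by a character. -/
def IsTwistSteinberg : Prop :=
  ∃ (c : ↥C.K →* 𝔽ˣ) (φ : ↥(PS1sub C 𝔽) →ₗ[𝔽] W), Function.Surjective φ ∧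
    (∀ f : ↥(PS1sub C 𝔽), φ f = 0 ↔ ∃ cc : 𝔽, (f : ↥C.K → 𝔽) = fun _ => cc) ∧
    (∀ (k : ↥C.K) (f f' : ↥(PS1sub C 𝔽)),
      (f' : ↥C.K → 𝔽) = PSact C 𝔽 k (f : ↥C.K → 𝔽) →
        φ f' = (c k : 𝔽) • σ k (φ f))


/-- The `K`-subrepresentation of the quotient `(ind_K^G σ) / (range T)` generated by the
image of a vector `v`. -/
def genQuot (T : Module.End 𝔽 ↥(IndSub C 𝔽 W σ)) (v : ↥(IndSub C 𝔽 W σ)) :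
    Submodule 𝔽 (↥(IndSub C 𝔽 W σ) ⧸ LinearMap.range T) :=
  Submodule.span 𝔽 {w | ∃ k ∈ C.K, w = Submodule.Quotient.mk (indRep C 𝔽 W σ k v)}

end Weight

/-- Smoothness of a representation of `G`: every vector is fixed by some congruence
subgroup (equivalently, has open stabilizer). -/
def SmoothRep {V : Type} [AddCommGroup V] [Module 𝔽 V] (ρ : Representation 𝔽 S.GG V) : Prop :=
  ∀ v : V, ∃ n : ℕ, ∀ g ∈ S.cong n, ρ g v = v

end RepTheory

end U21

namespace U21

namespace Setting

variable {S : Setting}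

section Fractional

lemma mem_pE_zero {x : S.E} : x ∈ S.pE 0 ↔ x ∈ S.O := by
  simp [pE]

lemma zpow_mem_O {k : ℤ} (hk : 0 ≤ k) : S.ϖ ^ k ∈ S.O := by
  lift k to ℕ using hk
  rw [zpow_natCast]
  exact pow_mem S.unif_mem k

lemma pE_mono {j k : ℤ} (h : j ≤ k) {x : S.E} (hx : x ∈ S.pE k) : x ∈ S.pE j := by
  obtain ⟨w, hw, rfl⟩ := hx
  refine ⟨S.ϖ ^ (k - j) * w, mul_mem (zpow_mem_O (by omega)) hw, ?_⟩
  rw [← mul_assoc, ← zpow_add₀ S.unif_ne]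
  congr 2
  omega

lemma zero_mem_pE (k : ℤ) : (0 : S.E) ∈ S.pE k := ⟨0, zero_mem _, by simp⟩

lemma pE_add {k : ℤ} {x y : S.E} (hx : x ∈ S.pE k) (hy : y ∈ S.pE k) : x + y ∈ S.pE k := by
  obtain ⟨v, hv, rfl⟩ := hx
  obtain ⟨w, hw, rfl⟩ := hy
  exact ⟨v + w, add_mem hv hw, by ring⟩

lemma pE_neg {k : ℤ} {x : S.E} (hx : x ∈ S.pE k) : -x ∈ S.pE k := by
  obtain ⟨v, hv, rfl⟩ := hx
  exact ⟨-v, neg_mem hv, by ring⟩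

lemma pE_sub {k : ℤ} {x y : S.E} (hx : x ∈ S.pE k) (hy : y ∈ S.pE k) : x - y ∈ S.pE k := by
  rw [sub_eq_add_neg]
  exact pE_add hx (pE_neg hy)

lemma pE_mul {j k : ℤ} {x y : S.E} (hx : x ∈ S.pE j) (hy : y ∈ S.pE k) :
    x * y ∈ S.pE (j + k) := by
  obtain ⟨v, hv, rfl⟩ := hx
  obtain ⟨w, hw, rfl⟩ := hy
  exact ⟨v * w, mul_mem hv hw, by rw [zpow_add₀ S.unif_ne]; ring⟩

lemma pE_mul_O {k : ℤ} {x y : S.E} (hx : x ∈ S.pE k) (hy : y ∈ S.O) : x * y ∈ S.pE k := by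
  simpa using pE_mul hx (mem_pE_zero.2 hy)

lemma pE_conj {k : ℤ} {x : S.E} (hx : x ∈ S.pE k) : S.conj x ∈ S.pE k := by
  obtain ⟨v, hv, rfl⟩ := hx
  exact ⟨S.conj v, S.conj_O v hv, by simp [S.unif_conj]⟩

lemma one_notMem_pE {k : ℤ} (hk : 1 ≤ k) : (1 : S.E) ∉ S.pE k := by
  intro h
  obtain ⟨w, hw, h1⟩ := pE_mono hk h
  refine S.unif_not_unit (IsUnit.of_mul_eq_one ⟨w, hw⟩ (Subtype.ext ?_))
  simpa using h1.symm

lemma coe_inv_mul_coe_unit (u : S.Oˣ) : (((u⁻¹ : S.Oˣ) : S.O) : S.E) * ((u : S.O) : S.E) = 1 := by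
  rw [← Subring.coe_mul, Units.inv_mul, Subring.coe_one]

/-- Norms detect the valuation. -/
lemma mem_pE_of_norm_mem {k j : ℤ} {x : S.E} (hx : x * S.conj x ∈ S.pE k)
    (hj : 2 * j ≤ k + 1) : x ∈ S.pE j := by
  by_cases h0 : x = 0
  · rw [h0]
    exact zero_mem_pE j
  obtain ⟨n, u, rfl⟩ := S.disc x h0
  refine pE_mono (k := n) ?_ ⟨u, (u : S.O).2, mul_comm _ _⟩
  by_contra! hn
  obtain ⟨v, hv⟩ : ∃ v : S.E, v = ((u⁻¹ : S.Oˣ) : S.O) := ⟨_, rfl⟩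
  have hvO : v ∈ S.O := hv ▸ ((u⁻¹ : S.Oˣ) : S.O).2
  have hvu : v * ((u : S.O) : S.E) = 1 := by rw [hv, coe_inv_mul_coe_unit]
  have hvu' : S.conj v * S.conj ((u : S.O) : S.E) = 1 := by rw [← map_mul, hvu, map_one]
  have hmem : S.ϖ ^ (2 * n) ∈ S.pE k := by
    have := pE_mul_O hx (mul_mem hvO (S.conj_O v hvO))
    convert this using 1
    rw [map_mul, map_zpow₀, S.unif_conj, two_mul, zpow_add₀ S.unif_ne]
    linear_combination (-(S.ϖ ^ n * S.ϖ ^ n)) * (hvu + v * (u : S.O) * hvu')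
  have h1 := pE_mul hmem (⟨1, one_mem _, by simp⟩ : S.ϖ ^ (-(2 * n)) ∈ S.pE (-(2 * n)))
  rw [← zpow_add₀ S.unif_ne, add_neg_cancel, zpow_zero] at h1
  exact one_notMem_pE (by omega) h1

lemma inv_mem_O_of_principal {d : S.E} (hd : d - 1 ∈ S.pE 1) :
    d ≠ 0 ∧ d ∈ S.O ∧ d⁻¹ ∈ S.O := by
  have hnot : d ∉ S.pE 1 := fun h => one_notMem_pE le_rfl (by simpa using pE_sub h hd)
  have h0 : d ≠ 0 := fun h => hnot (h ▸ zero_mem_pE 1)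
  have hdO : d ∈ S.O := by
    simpa using add_mem (mem_pE_zero.1 (pE_mono zero_le_one hd)) (one_mem S.O)
  refine ⟨h0, hdO, ?_⟩
  obtain ⟨n, u, rfl⟩ := S.disc d h0
  have hn : n ≤ 0 := by
    by_contra! hn
    exact hnot (pE_mono (k := n) (by omega) ⟨u, (u : S.O).2, mul_comm _ _⟩)
  rw [mul_inv, ← zpow_neg, inv_eq_of_mul_eq_one_left (coe_inv_mul_coe_unit u)]
  exact mul_mem (Subtype.prop _) (zpow_mem_O (by omega))

lemma principal_conj {d : S.E} (hd : d - 1 ∈ S.pE 1) : S.conj d - 1 ∈ S.pE 1 := by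
  simpa using pE_conj hd

lemma principal_inv {d : S.E} (hd : d - 1 ∈ S.pE 1) : d⁻¹ - 1 ∈ S.pE 1 := by
  obtain ⟨h0, -, hi⟩ := inv_mem_O_of_principal hd
  have := pE_neg (pE_mul_O hd hi)
  convert this using 1
  field_simp
  ring

lemma principal_mul {c d : S.E} (hc : c - 1 ∈ S.pE 1) (hd : d - 1 ∈ S.pE 1) :
    c * d - 1 ∈ S.pE 1 := by
  have := pE_add (pE_mul_O hc (inv_mem_O_of_principal hd).2.1) hd
  convert this using 1
  ring

end Fractional

section Matrices

/-- The diagonal matrix with entries `a`, `b`, `c`. -/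
def dM (a b c : S.E) : S.M3 := !![a, 0, 0; 0, b, 0; 0, 0, c]

lemma mat_mul (g h : S.GG) : S.mat (g * h) = S.mat g * S.mat h := rfl

lemma mat_one : S.mat 1 = 1 := rfl

lemma mat_injective : Function.Injective S.mat := fun _ _ h => Subtype.ext (Units.ext h)

lemma mat_unitary (g : S.GG) : (S.mat g).transpose * S.betaM * (S.mat g).map S.conj = S.betaM :=
  g.2

lemma exists_mat_eq {M : S.M3} (hM : M.transpose * S.betaM * M.map S.conj = S.betaM) :
    ∃ g : S.GG, S.mat g = M := by
  have hb : S.betaM.det ≠ 0 := by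
    intro h
    have := congrArg Matrix.det S.beta_mul_beta
    simp [h] at this
  have hd : M.det ≠ 0 := by
    intro h
    have := congrArg Matrix.det hM
    rw [Matrix.det_mul, Matrix.det_mul, Matrix.det_transpose, h, zero_mul, zero_mul] at this
    exact hb this.symm
  exact ⟨⟨Matrix.GeneralLinearGroup.mkOfDetNeZero M hd, hM⟩, rfl⟩

lemma exists_mat_eq_nM {x y : S.E} (h : x * S.conj x + y + S.conj y = 0) :
    ∃ g : S.GG, S.mat g = S.nM x y := by
  apply exists_mat_eq
  ext i j
  fin_cases i <;> fin_cases j <;>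
    simp [nM, betaM, Matrix.mul_apply, Fin.sum_univ_three, S.conj_invol]
  linear_combination h

lemma exists_mat_eq_n'M {x y : S.E} (h : x * S.conj x + y + S.conj y = 0) :
    ∃ g : S.GG, S.mat g = S.n'M x y := by
  apply exists_mat_eq
  ext i j
  fin_cases i <;> fin_cases j <;>
    simp [n'M, betaM, Matrix.mul_apply, Fin.sum_univ_three, S.conj_invol]
  linear_combination h

lemma exists_mat_eq_dM {a b c : S.E} (hac : a * S.conj c = 1) (hb : b * S.conj b = 1) :
    ∃ g : S.GG, S.mat g = dM a b c := by
  have hca : c * S.conj a = 1 := by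
    have := congrArg S.conj hac
    rw [map_mul, S.conj_invol, map_one] at this
    rw [mul_comm, this]
  apply exists_mat_eq
  ext i j
  fin_cases i <;> fin_cases j <;>
    simp [dM, betaM, Matrix.mul_apply, Fin.sum_univ_three, hac, hb, hca]

lemma dM_unitary {g : S.GG} {a b c : S.E} (hg : S.mat g = dM a b c) :
    a * S.conj c = 1 ∧ b * S.conj b = 1 ∧ c * S.conj a = 1 := by
  have h := mat_unitary g
  rw [hg] at h
  have h1 := congrFun (congrFun h 0) 2
  have h2 := congrFun (congrFun h 1) 1
  have h3 := congrFun (congrFun h 2) 0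
  simp [dM, betaM, Matrix.mul_apply, Fin.sum_univ_three] at h1 h2 h3
  exact ⟨h1, h2, h3⟩

lemma nM_mul (x y z t : S.E) :
    S.nM x y * S.nM z t = S.nM (x + z) (y + t - x * S.conj z) := by
  ext i j
  fin_cases i <;> fin_cases j <;> simp [nM, Matrix.mul_apply, Fin.sum_univ_three] <;> ring

lemma n'M_mul (x y z t : S.E) :
    S.n'M x y * S.n'M z t = S.n'M (x + z) (y + t - S.conj x * z) := by
  ext i j
  fin_cases i <;> fin_cases j <;> simp [n'M, Matrix.mul_apply, Fin.sum_univ_three] <;> ring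

lemma nM_zero : S.nM 0 0 = 1 := by
  ext i j
  fin_cases i <;> fin_cases j <;> simp [nM]

lemma n'M_zero : S.n'M 0 0 = 1 := by
  ext i j
  fin_cases i <;> fin_cases j <;> simp [n'M]

lemma mat_inv_nM {g : S.GG} {x y : S.E} (h : x * S.conj x + y + S.conj y = 0)
    (hg : S.mat g = S.nM x y) : S.mat g⁻¹ = S.nM (-x) (S.conj y) := by
  obtain ⟨k, hk⟩ := exists_mat_eq_nM (S := S) (x := -x) (y := S.conj y)
    (by simp only [map_neg, S.conj_invol]; linear_combination h)
  rw [← hk]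
  congr 1
  refine inv_eq_of_mul_eq_one_right (mat_injective ?_)
  rw [mat_mul, hg, hk, nM_mul, mat_one, ← nM_zero]
  congr 1
  · ring
  · rw [map_neg]
    linear_combination h

lemma mat_inv_n'M {g : S.GG} {x y : S.E} (h : x * S.conj x + y + S.conj y = 0)
    (hg : S.mat g = S.n'M x y) : S.mat g⁻¹ = S.n'M (-x) (S.conj y) := by
  obtain ⟨k, hk⟩ := exists_mat_eq_n'M (S := S) (x := -x) (y := S.conj y)
    (by simp only [map_neg, S.conj_invol]; linear_combination h)
  rw [← hk]
  congr 1
  refine inv_eq_of_mul_eq_one_right (mat_injective ?_)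
  rw [mat_mul, hg, hk, n'M_mul, mat_one, ← n'M_zero]
  congr 1
  · ring
  · linear_combination h

/-- The coordinates of a factorization `n'(a,b) n(x,y) = n(x₁,y₁) diag(c₁,c₂,c₃) n'(x₂,y₂)`
that can be read off from the last row and column. -/
lemma factorization_coords {a b x y x₁ y₁ c₁ c₂ c₃ x₂ y₂ : S.E}
    (h : S.n'M a b * S.nM x y = S.nM x₁ y₁ * dM c₁ c₂ c₃ * S.n'M x₂ y₂) :
    c₃ = 1 + b * y + S.conj a * S.conj x ∧ y₁ * c₃ = y ∧
      S.conj x₁ * c₃ = S.conj x - a * y ∧ c₃ * y₂ = b ∧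
      c₃ * S.conj x₂ = S.conj a - b * x := by
  have h02 := congrFun (congrFun h 0) 2
  have h12 := congrFun (congrFun h 1) 2
  have h20 := congrFun (congrFun h 2) 0
  have h21 := congrFun (congrFun h 2) 1
  have h22 := congrFun (congrFun h 2) 2
  simp [nM, n'M, dM, Matrix.mul_apply, Fin.sum_univ_three] at h02 h12 h20 h21 h22
  refine ⟨?_, ?_, ?_, ?_, ?_⟩
  · linear_combination -h22
  · linear_combination -h02
  · linear_combination h12
  · linear_combination -h20
  · linear_combination h21

/-- The big cell factorization of `n'(a,b) n(x,y)`. -/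
lemma factorization_exists {a b x y D : S.E} (hab : a * S.conj a + b + S.conj b = 0)
    (hxy : x * S.conj x + y + S.conj y = 0) (hD : D = 1 + b * y + S.conj a * S.conj x)
    (hD0 : D ≠ 0) :
    S.n'M a b * S.nM x y =
      S.nM ((x - S.conj a * S.conj y) / S.conj D) (y / D) *
        dM (S.conj D)⁻¹ (S.conj D / D) D *
          S.n'M ((a - S.conj b * S.conj x) / S.conj D) (b / D) := by
  have hD0' : S.conj D ≠ 0 := (map_ne_zero _).2 hD0
  have hD' : S.conj D = 1 + S.conj b * S.conj y + a * x := by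
    rw [hD]
    simp [S.conj_invol]
  have hb : S.conj b = -(a * S.conj a) - b := by linear_combination hab
  have hy : S.conj y = -(x * S.conj x) - y := by linear_combination hxy
  ext i j
  fin_cases i <;> fin_cases j <;>
    simp [nM, n'M, dM, Matrix.mul_apply, Fin.sum_univ_three, S.conj_invol] <;>
    field_simp <;> (try simp only [hD', hb, hy]) <;> (try rw [hD]) <;> ring

end Matrices

section Filtration

lemma one_mem_Nk (k : ℤ) : (1 : S.GG) ∈ S.Nk k :=
  ⟨0, 0, by simp, zero_mem_pE k, by rw [mat_one, nM_zero]⟩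

lemma Nk_mono {j k : ℤ} (h : j ≤ k) {g : S.GG} (hg : g ∈ S.Nk k) : g ∈ S.Nk j := by
  obtain ⟨x, y, hxy, hy, hg⟩ := hg
  exact ⟨x, y, hxy, pE_mono h hy, hg⟩

lemma norm_mem_pE {x y : S.E} {k : ℤ} (hxy : x * S.conj x + y + S.conj y = 0)
    (hy : y ∈ S.pE k) : x * S.conj x ∈ S.pE k := by
  have := pE_neg (pE_add hy (pE_conj hy))
  convert this using 1
  linear_combination hxy

lemma inv_mul_mem_Nk {n : ℤ} (hn : n = 0 ∨ n = -1) {u w : S.GG} (hu : u ∈ S.Nk n)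
    (hw : w ∈ S.Nk n) : u⁻¹ * w ∈ S.Nk n := by
  obtain ⟨x, y, hxy, hy, hu⟩ := hu
  obtain ⟨z, t, hzt, ht, hw⟩ := hw
  have hx0 := mem_pE_of_norm_mem (j := 0) (norm_mem_pE hxy hy) (by omega)
  have hz0 := mem_pE_of_norm_mem (j := 0) (norm_mem_pE hzt ht) (by omega)
  refine ⟨-x + z, S.conj y + t - -x * S.conj z, ?_, ?_, ?_⟩
  · simp only [map_add, map_sub, map_mul, map_neg, S.conj_invol]
    linear_combination hxy + hzt
  · refine pE_sub (pE_add (pE_conj hy) ht) (pE_mono (by omega) (pE_mul (pE_neg hx0) (pE_conj hz0)))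
  · rw [mat_mul, mat_inv_nM hxy hu, hw, nM_mul]

lemma inv_mem_N'k {k : ℤ} {u : S.GG} (hu : u ∈ S.N'k k) : u⁻¹ ∈ S.N'k k := by
  obtain ⟨x, y, hxy, hy, hu⟩ := hu
  refine ⟨-x, S.conj y, ?_, pE_conj hy, mat_inv_n'M hxy hu⟩
  simp only [map_neg, S.conj_invol]
  linear_combination hxy

/-- The diagonal elements with entries congruent to `1` modulo `p_E`. -/
def Hone (S : Setting) : Set S.GG :=
  {g | ∃ a b c : S.E, S.mat g = dM a b c ∧ a - 1 ∈ S.pE 1 ∧ b - 1 ∈ S.pE 1 ∧ c - 1 ∈ S.pE 1}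

lemma mul_mem_Hone {g h : S.GG} (hg : g ∈ Hone S) (hh : h ∈ Hone S) : g * h ∈ Hone S := by
  obtain ⟨a, b, c, hg, ha, hb, hc⟩ := hg
  obtain ⟨a', b', c', hh, ha', hb', hc'⟩ := hh
  refine ⟨a * a', b * b', c * c', ?_, principal_mul ha ha', principal_mul hb hb',
    principal_mul hc hc'⟩
  rw [mat_mul, hg, hh]
  ext i j
  fin_cases i <;> fin_cases j <;> simp [dM, Matrix.mul_apply, Fin.sum_univ_three]

lemma inv_mem_Hone {g : S.GG} (hg : g ∈ Hone S) : g⁻¹ ∈ Hone S := by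
  obtain ⟨a, b, c, hg, ha, hb, hc⟩ := hg
  obtain ⟨hac, hbb, hca⟩ := dM_unitary hg
  obtain ⟨k, hk⟩ := exists_mat_eq_dM (S := S) (a := S.conj c) (b := S.conj b) (c := S.conj a)
    (by rw [S.conj_invol, mul_comm, hac]) (by rw [S.conj_invol, mul_comm, hbb])
  refine ⟨S.conj c, S.conj b, S.conj a, ?_, principal_conj hc, principal_conj hb,
    principal_conj ha⟩
  rw [← hk]
  congr 1
  refine inv_eq_of_mul_eq_one_right (mat_injective ?_)
  rw [mat_mul, hg, hk, mat_one]
  ext i j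
  fin_cases i <;> fin_cases j <;>
    simp [dM, Matrix.mul_apply, Fin.sum_univ_three, hac, hbb, hca]

lemma conj_mem_Nk {k : ℤ} {h u : S.GG} (hh : h ∈ Hone S) (hu : u ∈ S.Nk k) :
    h * u * h⁻¹ ∈ S.Nk k := by
  obtain ⟨a, b, c, hh, ha, hb, hc⟩ := hh
  obtain ⟨x, y, hxy, hy, hu⟩ := hu
  obtain ⟨hac, hbb, hca⟩ := dM_unitary hh
  have hxy' : a * S.conj b * x * S.conj (a * S.conj b * x) + a * S.conj a * y +
      S.conj (a * S.conj a * y) = 0 := by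
    simp only [map_mul, S.conj_invol]
    linear_combination a * S.conj a * (x * S.conj x * hbb + hxy)
  refine ⟨a * S.conj b * x, a * S.conj a * y, hxy', ?_, ?_⟩
  · rw [mul_comm]
    have haO := (inv_mem_O_of_principal ha).2.1
    exact pE_mul_O hy (mul_mem haO (S.conj_O a haO))
  · obtain ⟨g, hg⟩ := exists_mat_eq_nM hxy'
    rw [← hg]
    congr 1
    rw [mul_inv_eq_iff_eq_mul]
    apply mat_injective
    rw [mat_mul, mat_mul, hh, hu, hg]
    ext i j
    fin_cases i <;> fin_cases j <;>
      simp [nM, dM, Matrix.mul_apply, Fin.sum_univ_three, S.conj_invol]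
    · linear_combination -(a * x) * hbb
    · linear_combination -(a * y) * hca
    · linear_combination -(b * S.conj x) * hca

lemma conj_mem_N'k {k : ℤ} {h u : S.GG} (hh : h ∈ Hone S) (hu : u ∈ S.N'k k) :
    h * u * h⁻¹ ∈ S.N'k k := by
  obtain ⟨a, b, c, hh, ha, hb, hc⟩ := hh
  obtain ⟨x, y, hxy, hy, hu⟩ := hu
  obtain ⟨hac, hbb, hca⟩ := dM_unitary hh
  have hxy' : b * S.conj c * x * S.conj (b * S.conj c * x) + c * S.conj c * y +
      S.conj (c * S.conj c * y) = 0 := by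
    simp only [map_mul, S.conj_invol]
    linear_combination c * S.conj c * (x * S.conj x * hbb + hxy)
  refine ⟨b * S.conj c * x, c * S.conj c * y, hxy', ?_, ?_⟩
  · rw [mul_comm]
    have hcO := (inv_mem_O_of_principal hc).2.1
    exact pE_mul_O hy (mul_mem hcO (S.conj_O c hcO))
  · obtain ⟨g, hg⟩ := exists_mat_eq_n'M hxy'
    rw [← hg]
    congr 1
    rw [mul_inv_eq_iff_eq_mul]
    apply mat_injective
    rw [mat_mul, mat_mul, hh, hu, hg]
    ext i j
    fin_cases i <;> fin_cases j <;>
      simp [n'M, dM, Matrix.mul_apply, Fin.sum_univ_three, S.conj_invol]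
    · linear_combination -(b * x) * hac
    · linear_combination -(c * y) * hac
    · linear_combination -(c * S.conj x) * hbb

end Filtration

section Iwahori

variable {n m : ℤ}

lemma principal_denominator (hnm : n = 0 ∧ m = 1 ∨ n = -1 ∧ m = 2) {a b x y : S.E}
    (hab : a * S.conj a + b + S.conj b = 0) (hb : b ∈ S.pE m)
    (hxy : x * S.conj x + y + S.conj y = 0) (hy : y ∈ S.pE n) :
    1 + b * y + S.conj a * S.conj x - 1 ∈ S.pE 1 := by
  have ha1 := mem_pE_of_norm_mem (j := 1) (norm_mem_pE hab hb) (by omega)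
  have hx0 := mem_pE_of_norm_mem (j := 0) (norm_mem_pE hxy hy) (by omega)
  have h := pE_add (pE_mono (j := 1) (by omega) (pE_mul hb hy))
    (pE_mono (j := 1) (by omega) (pE_mul (pE_conj ha1) (pE_conj hx0)))
  convert h using 1
  ring

lemma iwahori_exists (hnm : n = 0 ∧ m = 1 ∨ n = -1 ∧ m = 2) {u' u : S.GG}
    (hu' : u' ∈ S.N'k m) (hu : u ∈ S.Nk n) :
    ∃ u₁ ∈ S.Nk n, ∃ h ∈ Hone S, ∃ w' ∈ S.N'k m, u' * u = u₁ * h * w' := by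
  obtain ⟨a, b, hab, hb, hu'⟩ := hu'
  obtain ⟨x, y, hxy, hy, hu⟩ := hu
  have hD1 := principal_denominator hnm hab hb hxy hy
  obtain ⟨D, hD⟩ : ∃ D, D = 1 + b * y + S.conj a * S.conj x := ⟨_, rfl⟩
  rw [← hD] at hD1
  obtain ⟨hD0, hDO, hDi⟩ := inv_mem_O_of_principal hD1
  have hD0' : S.conj D ≠ 0 := (map_ne_zero _).2 hD0
  have hD' : S.conj D = 1 + S.conj b * S.conj y + a * x := by
    rw [hD]
    simp [S.conj_invol]
  have h₁ : (x - S.conj a * S.conj y) / S.conj D * S.conj ((x - S.conj a * S.conj y) / S.conj D)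
      + y / D + S.conj (y / D) = 0 := by
    simp only [map_div₀, map_sub, map_mul, S.conj_invol]
    field_simp
    rw [hD', hD]
    linear_combination (y * S.conj y) * hab + hxy
  have h₂ : (a - S.conj b * S.conj x) / S.conj D * S.conj ((a - S.conj b * S.conj x) / S.conj D)
      + b / D + S.conj (b / D) = 0 := by
    simp only [map_div₀, map_sub, map_mul, S.conj_invol]
    field_simp
    rw [hD', hD]
    linear_combination (b * S.conj b) * hxy + hab
  obtain ⟨u₁, hu₁⟩ := exists_mat_eq_nM h₁
  obtain ⟨w', hw'⟩ := exists_mat_eq_n'M h₂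
  obtain ⟨h, hh⟩ := exists_mat_eq_dM (S := S) (a := (S.conj D)⁻¹) (b := S.conj D / D) (c := D)
    (inv_mul_cancel₀ hD0') (by rw [map_div₀, S.conj_invol]; field_simp)
  refine ⟨u₁, ⟨_, _, h₁, div_eq_mul_inv y D ▸ pE_mul_O hy hDi, hu₁⟩, h, ⟨_, _, _, hh, ?_, ?_, hD1⟩, w',
    ⟨_, _, h₂, div_eq_mul_inv b D ▸ pE_mul_O hb hDi, hw'⟩, ?_⟩
  · exact principal_inv (principal_conj hD1)
  · rw [div_eq_mul_inv]
    exact principal_mul (principal_conj hD1) (principal_inv hD1)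
  · apply mat_injective
    rw [mat_mul, mat_mul, mat_mul, hu', hu, hu₁, hh, hw']
    exact factorization_exists hab hxy hD hD0

lemma iwahori_unique {u₁ v₁ h k w' z' g : S.GG} {i j : ℤ} {u' u : S.GG}
    (hu' : u' ∈ S.N'k j) (hu : u ∈ S.Nk i) (hu₁ : u₁ ∈ S.Nk i) (hv₁ : v₁ ∈ S.Nk i)
    (hh : h ∈ Hone S) (hk : k ∈ Hone S) (hw' : w' ∈ S.N'k j) (hz' : z' ∈ S.N'k j)
    (hg : g = u' * u) (h₁ : g = u₁ * h * w') (h₂ : g = v₁ * k * z') :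
    u₁ = v₁ ∧ h = k ∧ w' = z' := by
  obtain ⟨a, b, -, -, hu'⟩ := hu'
  obtain ⟨x, y, -, -, hu⟩ := hu
  obtain ⟨x₁, y₁, -, -, hu₁⟩ := hu₁
  obtain ⟨x₂, y₂, -, -, hv₁⟩ := hv₁
  obtain ⟨x₃, y₃, -, -, hw'⟩ := hw'
  obtain ⟨x₄, y₄, -, -, hz'⟩ := hz'
  obtain ⟨a₁, b₁, c₁, hh, -, -, hc₁⟩ := hh
  obtain ⟨a₂, b₂, c₂, hk, -, -, -⟩ := hk
  have e₁ := congrArg S.mat (hg.symm.trans h₁)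
  have e₂ := congrArg S.mat (hg.symm.trans h₂)
  simp only [mat_mul, hu', hu, hu₁, hv₁, hw', hz', hh, hk] at e₁ e₂
  obtain ⟨p₁, p₂, p₃, p₄, p₅⟩ := factorization_coords e₁
  obtain ⟨q₁, q₂, q₃, q₄, q₅⟩ := factorization_coords e₂
  have hc0 := (inv_mem_O_of_principal hc₁).1
  obtain rfl : c₁ = c₂ := p₁.trans q₁.symm
  have hconj : Function.Injective S.conj := S.conj.injective
  obtain rfl : y₁ = y₂ := mul_right_cancel₀ hc0 (p₂.trans q₂.symm)
  obtain rfl : x₁ = x₂ := hconj (mul_right_cancel₀ hc0 (p₃.trans q₃.symm))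
  obtain rfl : y₃ = y₄ := mul_left_cancel₀ hc0 (p₄.trans q₄.symm)
  obtain rfl : x₃ = x₄ := hconj (mul_left_cancel₀ hc0 (p₅.trans q₅.symm))
  obtain rfl : u₁ = v₁ := mat_injective (hu₁.trans hv₁.symm)
  obtain rfl : w' = z' := mat_injective (hw'.trans hz'.symm)
  exact ⟨rfl, mul_left_cancel (mul_right_cancel (h₁.symm.trans h₂)), rfl⟩

/-- The `N`-component of the decomposition lies in the same filtration steps as `u`. -/
lemma iwahori_mem_Nk_iff {k i j : ℤ} {u' u u₁ h w' : S.GG} (hu' : u' ∈ S.N'k j) (hu : u ∈ S.Nk i)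
    (hu₁ : u₁ ∈ S.Nk i) (hh : h ∈ Hone S) (hw' : w' ∈ S.N'k j) (e : u' * u = u₁ * h * w') :
    u ∈ S.Nk k ↔ u₁ ∈ S.Nk k := by
  obtain ⟨a, b, -, -, hu'⟩ := hu'
  obtain ⟨x, y, hxy, -, hu⟩ := hu
  obtain ⟨x₁, y₁, hxy₁, -, hu₁⟩ := hu₁
  obtain ⟨x₂, y₂, -, -, hw'⟩ := hw'
  obtain ⟨a₁, b₁, c, hh, -, -, hc⟩ := hh
  have e₁ := congrArg S.mat e
  simp only [mat_mul, hu', hu, hu₁, hw', hh] at e₁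
  obtain ⟨-, p, -⟩ := factorization_coords e₁
  obtain ⟨hc0, hcO, hci⟩ := inv_mem_O_of_principal hc
  have key : ∀ {g : S.GG} {x y : S.E}, x * S.conj x + y + S.conj y = 0 → S.mat g = S.nM x y →
      (g ∈ S.Nk k ↔ y ∈ S.pE k) := by
    intro g x y hxy hg
    refine ⟨?_, fun hy => ⟨x, y, hxy, hy, hg⟩⟩
    rintro ⟨x', y', -, hy', hg'⟩
    have := congrFun (congrFun (hg.symm.trans hg') 0) 2
    simp [nM] at this
    rwa [this]
  rw [key hxy hu, key hxy₁ hu₁]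
  constructor
  · intro hy
    have := pE_mul_O hy hci
    rwa [← p, mul_inv_cancel_right₀ hc0] at this
  · intro hy
    rw [← p]
    exact pE_mul_O hy hcO

lemma iwahori_coset_iff (hnm : n = 0 ∧ m = 1 ∨ n = -1 ∧ m = 2) {k : ℤ}
    {u' u u₁ h w' w w₁ h₂ w₂' : S.GG} (hu' : u' ∈ S.N'k m)
    (hu : u ∈ S.Nk n) (hu₁ : u₁ ∈ S.Nk n) (hh : h ∈ Hone S) (hw' : w' ∈ S.N'k m)
    (hw : w ∈ S.Nk n) (hw₁ : w₁ ∈ S.Nk n) (hh₂ : h₂ ∈ Hone S) (hw₂' : w₂' ∈ S.N'k m)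
    (e : u' * u = u₁ * h * w') (e₂ : u' * w = w₁ * h₂ * w₂') :
    u⁻¹ * w ∈ S.Nk k ↔ u₁⁻¹ * w₁ ∈ S.Nk k := by
  have hn : n = 0 ∨ n = -1 := by omega
  have hv := inv_mul_mem_Nk hn hu hw
  obtain ⟨v₁, hv₁, h', hh', w'', hw'', e₃⟩ := iwahori_exists hnm hw' hv
  have hconj := conj_mem_Nk hh hv₁
  have hmem : u₁ * (h * v₁ * h⁻¹) ∈ S.Nk n := by
    have := inv_mul_mem_Nk hn (inv_mul_mem_Nk hn hu₁ (one_mem_Nk n)) hconj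
    rwa [mul_one, inv_inv] at this
  have e₄ : u' * w = u₁ * (h * v₁ * h⁻¹) * (h * h') * w'' := by
    calc u' * w = u' * u * (u⁻¹ * w) := by group
      _ = u₁ * h * (w' * (u⁻¹ * w)) := by rw [e]; group
      _ = _ := by rw [e₃]; group
  obtain ⟨rfl, -, -⟩ := iwahori_unique hu' hw hw₁ hmem hh₂ (mul_mem_Hone hh hh') hw₂' hw'' rfl e₂ e₄
  rw [iwahori_mem_Nk_iff hw' hv hv₁ hh' hw'' e₃, inv_mul_cancel_left]
  refine ⟨conj_mem_Nk hh, fun hm => ?_⟩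
  have := conj_mem_Nk (inv_mem_Hone hh) hm
  convert this using 1
  group

lemma iwahori_surjective (hnm : n = 0 ∧ m = 1 ∨ n = -1 ∧ m = 2) {k : ℤ} (hk : n ≤ k)
    {u' z : S.GG} (hu' : u' ∈ S.N'k m) (hz : z ∈ S.Nk k) :
    ∃ u ∈ S.Nk k, ∃ h ∈ Hone S, ∃ w' ∈ S.N'k m, u' * u = z * h * w' := by
  obtain ⟨u, hu, h, hh, w', hw', e⟩ := iwahori_exists hnm (inv_mem_N'k hu') (Nk_mono hk hz)
  refine ⟨u, (iwahori_mem_Nk_iff (inv_mem_N'k hu') (Nk_mono hk hz) hu hh hw' e).1 hz, h⁻¹,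
    inv_mem_Hone hh, h * w'⁻¹ * h⁻¹, conj_mem_N'k hh (inv_mem_N'k hw'), ?_⟩
  have hu_eq : u = u'⁻¹ * z * w'⁻¹ * h⁻¹ := by
    rw [e]
    group
  rw [hu_eq]
  group

end Iwahori

end Setting

namespace Chamber

variable {S : Setting} (C : Chamber S)

lemma nK_mK : C.nK = 0 ∧ C.mK = 1 ∨ C.nK = -1 ∧ C.mK = 2 := by
  obtain ⟨-, -, -, -, -, -, hn, hm, -⟩ | ⟨-, -, -, -, -, -, hn, hm, -⟩ := C.cases
  · exact Or.inl ⟨hn, hm⟩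
  · exact Or.inr ⟨hn, hm⟩

lemma H1_eq : C.H1 = Setting.Hone S := by
  ext g
  constructor
  · rintro ⟨⟨a, b, c, hg⟩, hI⟩
    refine ⟨a, b, c, hg, ?_⟩
    obtain ⟨-, -, -, h1, -⟩ | ⟨-, -, -, h1, -⟩ := C.cases <;> rw [h1] at hI <;>
      obtain ⟨-, ha, hb, hc⟩ := hI <;> rw [hg] at ha hb hc <;> exact ⟨ha, hb, hc⟩
  · rintro ⟨a, b, c, hg, ha, hb, hc⟩
    refine ⟨⟨a, b, c, hg⟩, ?_⟩
    have haO := (Setting.inv_mem_O_of_principal ha).2.1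
    have hbO := (Setting.inv_mem_O_of_principal hb).2.1
    have hcO := (Setting.inv_mem_O_of_principal hc).2.1
    have h0 := Setting.zero_mem_pE (S := S)
    obtain ⟨-, -, -, h1, -⟩ | ⟨-, -, -, h1, -⟩ := C.cases
    · rw [h1]
      refine ⟨⟨fun i j => ?_, ?_, ?_, ?_⟩, ?_, ?_, ?_⟩
      · rw [hg]
        fin_cases i <;> fin_cases j <;> simp [Setting.dM, haO, hbO, hcO]
      all_goals simp [hg, Setting.dM, h0, ha, hb, hc]
    · rw [h1]
      simp [Setting.I1K1, Setting.IK1, Setting.K1set, hg, Setting.dM, h0, ha, hb, hc, haO, hbO, hcO]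

end Chamber

/-- (1) Every product `u' u` with `u' ∈ N'_{m_K}`, `u ∈ N_{n_K}` has a
unique decomposition `u' u = u₁ h u'₁` with `u₁ ∈ N_{n_K}`, `h ∈ H₁`, `u'₁ ∈ N'_{m_K}`.
(2) The assignment `u ↦ u₁` preserves the filtration `N_{n_K + l}` and induces a bijection
on cosets `N_{n_K+l}/N_{n_K+m}`. -/
theorem stmt16 (S : Setting) (C : Chamber S) :
    (∀ u' ∈ S.N'k C.mK, ∀ u ∈ S.Nk C.nK,
      ∃! z : S.GG × S.GG × S.GG, z.1 ∈ S.Nk C.nK ∧ z.2.1 ∈ C.H1 ∧ z.2.2 ∈ S.N'k C.mK ∧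
        u' * u = z.1 * z.2.1 * z.2.2) ∧
    (∀ u' ∈ S.N'k C.mK, ∀ l m : ℤ, 0 ≤ l → l < m →
      (∀ u u₁ h w', u ∈ S.Nk C.nK → u₁ ∈ S.Nk C.nK → h ∈ C.H1 → w' ∈ S.N'k C.mK →
        u' * u = u₁ * h * w' → (u ∈ S.Nk (C.nK + l) ↔ u₁ ∈ S.Nk (C.nK + l))) ∧
      (∀ u u₁ h w' w w₁ h₂ w₂',
        u ∈ S.Nk C.nK → u₁ ∈ S.Nk C.nK → h ∈ C.H1 → w' ∈ S.N'k C.mK →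
        w ∈ S.Nk C.nK → w₁ ∈ S.Nk C.nK → h₂ ∈ C.H1 → w₂' ∈ S.N'k C.mK →
        u' * u = u₁ * h * w' → u' * w = w₁ * h₂ * w₂' →
        (u⁻¹ * w ∈ S.Nk (C.nK + m) ↔ u₁⁻¹ * w₁ ∈ S.Nk (C.nK + m))) ∧
      (∀ z ∈ S.Nk (C.nK + l), ∃ u u₁ h w',
        u ∈ S.Nk (C.nK + l) ∧ u₁ ∈ S.Nk C.nK ∧ h ∈ C.H1 ∧ w' ∈ S.N'k C.mK ∧
        u' * u = u₁ * h * w' ∧ u₁⁻¹ * z ∈ S.Nk (C.nK + m))) := by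
  have hnm := C.nK_mK
  rw [C.H1_eq]
  refine ⟨fun u' hu' u hu => ?_, fun u' hu' l m hl _ => ⟨?_, ?_, ?_⟩⟩
  · obtain ⟨u₁, hu₁, h, hh, w', hw', e⟩ := Setting.iwahori_exists hnm hu' hu
    refine ⟨(u₁, h, w'), ⟨hu₁, hh, hw', e⟩, ?_⟩
    rintro ⟨v₁, k, z'⟩ ⟨hv₁, hk, hz', e'⟩
    obtain ⟨rfl, rfl, rfl⟩ :=
      Setting.iwahori_unique hu' hu hu₁ hv₁ hh hk hw' hz' rfl e e'
    rfl
  · intro u u₁ h w' hu hu₁ hh hw' e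
    exact Setting.iwahori_mem_Nk_iff hu' hu hu₁ hh hw' e
  · intro u u₁ h w' w w₁ h₂ w₂' hu hu₁ hh hw' hw hw₁ hh₂ hw₂' e e₂
    exact Setting.iwahori_coset_iff hnm hu' hu hu₁ hh hw' hw hw₁ hh₂ hw₂' e e₂
  · intro z hz
    obtain ⟨u, hu, h, hh, w', hw', e⟩ :=
      Setting.iwahori_surjective hnm (le_add_of_nonneg_right hl) hu' hz
    refine ⟨u, z, h, w', hu, Setting.Nk_mono (le_add_of_nonneg_right hl) hz, hh, hw', e, ?_⟩
    rw [inv_mul_cancel]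
    exact Setting.one_mem_Nk _

end U21
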